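/- arXiv:1409.8385 — 2 statements merged into one kernel-verified Lean document; each statement's English description precedes it below -/
import Mathlib

section
/- (Proposition 1, orthogonality.) Let z₁, z₂, z₃, z₄ ∈ ℂ be pairwise distinct, q₁, q₂, q₃, q₄ ∈ ℂ, λ₁, λ₂ ∈ ℂ with λ₁ ≠ λ₂, and P(z) = ∏_{j=1}^4 (z − z_j). Let U ⊆ ℂ be open with U ∩ {z₁,z₂,z₃,z₄} = ∅, let S : U → ℂ be differentiable with S(z)² = P(z) and S(z) ≠ 0 on U, and let F₁, F₂ : U → ℂ be twice differentiable functions satisfying the symmetric Heun equation with data (z₁,…,z₄; q₁,…,q₄; λ₁) and (z₁,…,z₄; q₁,…,q₄; λ₂), respectively, at every point of U. Let γ : (0,1) → U be a continuously differentiable path, and suppose the function W(t) = S(γ(t))·(F₁(γ(t))·F₂'(γ(t)) − F₂(γ(t))·F₁'(γ(t))) tends to 0 as t → 0⁺ and as t → 1⁻, and that the function t ↦ F₁(γ(t))·F₂(γ(t))·γ'(t)/S(γ(t)) is integrable on (0,1). Then ∫₀¹ F₁(γ(t))·F₂(γ(t))·γ'(t)/S(γ(t)) dt = 0. -/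
open Complex MeasureTheory

/-- `F` satisfies the symmetric Heun equation with data
`(z₁,…,z₄; q₁,…,q₄; λ)` at the point `z`. -/
def SatisfiesHeun (z₁ z₂ z₃ z₄ q₁ q₂ q₃ q₄ lam : ℂ) (F : ℂ → ℂ) (z : ℂ) : Prop :=
  deriv (deriv F) z
    + (1 / 2) * (1 / (z - z₁) + 1 / (z - z₂) + 1 / (z - z₃) + 1 / (z - z₄)) * deriv F z
    + (1 / ((z - z₁) * (z - z₂) * (z - z₃) * (z - z₄)))
      * (lam + q₁ / (z - z₁) + q₂ / (z - z₂) + q₃ / (z - z₃) + q₄ / (z - z₄)) * F z = 0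

/-- A branch `S` of `√P` satisfies `S' = (S / 2) ∑ⱼ 1 / (z - zⱼ)`. -/
theorem hasDerivAt_sqrt_quartic {z₁ z₂ z₃ z₄ z : ℂ} {S : ℂ → ℂ} {U : Set ℂ} (hU : U ∈ nhds z)
    (hS : DifferentiableAt ℂ S z)
    (hSsq : ∀ w ∈ U, S w ^ 2 = (w - z₁) * (w - z₂) * (w - z₃) * (w - z₄)) (hS0 : S z ≠ 0) :
    HasDerivAt S (S z * ((1 / 2) * (1 / (z - z₁) + 1 / (z - z₂) + 1 / (z - z₃) + 1 / (z - z₄))))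
      z := by
  have hsq := hSsq z (mem_of_mem_nhds hU)
  have hP : (z - z₁) * (z - z₂) * (z - z₃) * (z - z₄) ≠ 0 := hsq ▸ pow_ne_zero 2 hS0
  simp only [mul_ne_zero_iff] at hP
  obtain ⟨⟨⟨h₁, h₂⟩, h₃⟩, h₄⟩ := hP
  have hlin (c : ℂ) : HasDerivAt (fun w => w - c) 1 z := (hasDerivAt_id z).sub_const c
  have hPd := (((hlin z₁).fun_mul (hlin z₂)).fun_mul (hlin z₃)).fun_mul (hlin z₄)
  have hSd := hS.hasDerivAt.fun_pow 2
  have heq := hSd.unique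
    (hPd.congr_of_eventuallyEq (Filter.eventually_of_mem hU hSsq))
  refine hS.hasDerivAt.congr_deriv (Eq.symm ?_)
  apply mul_left_cancel₀ (mul_ne_zero two_ne_zero hS0)
  have hmul : 2 * S z * (S z * ((1 / 2) *
      (1 / (z - z₁) + 1 / (z - z₂) + 1 / (z - z₃) + 1 / (z - z₄)))) =
      S z ^ 2 * (1 / (z - z₁) + 1 / (z - z₂) + 1 / (z - z₃) + 1 / (z - z₄)) := by ring
  rw [hmul, hsq]
  norm_num at heq
  rw [heq]
  field_simp

/-- The weighted Wronskian of solutions of two Heun equations that differ only in their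
eigenvalues has derivative `(λ₁ - λ₂) F₁ F₂ / S`. -/
theorem SatisfiesHeun.hasDerivAt_wronskian {z₁ z₂ z₃ z₄ q₁ q₂ q₃ q₄ lam₁ lam₂ z : ℂ}
    {S F₁ F₂ : ℂ → ℂ}
    (hS : HasDerivAt S
      (S z * ((1 / 2) * (1 / (z - z₁) + 1 / (z - z₂) + 1 / (z - z₃) + 1 / (z - z₄)))) z)
    (hsq : S z ^ 2 = (z - z₁) * (z - z₂) * (z - z₃) * (z - z₄)) (hS0 : S z ≠ 0)
    (hF₁ : DifferentiableAt ℂ F₁ z) (hF₁' : DifferentiableAt ℂ (deriv F₁) z)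
    (hF₂ : DifferentiableAt ℂ F₂ z) (hF₂' : DifferentiableAt ℂ (deriv F₂) z)
    (heq₁ : SatisfiesHeun z₁ z₂ z₃ z₄ q₁ q₂ q₃ q₄ lam₁ F₁ z)
    (heq₂ : SatisfiesHeun z₁ z₂ z₃ z₄ q₁ q₂ q₃ q₄ lam₂ F₂ z) :
    HasDerivAt (fun w => S w * (F₁ w * deriv F₂ w - F₂ w * deriv F₁ w))
      ((lam₁ - lam₂) * (F₁ z * F₂ z / S z)) z := by
  refine (hS.fun_mul ((hF₁.hasDerivAt.fun_mul hF₂'.hasDerivAt).fun_sub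
    (hF₂.hasDerivAt.fun_mul hF₁'.hasDerivAt))).congr_deriv (Eq.symm ?_)
  unfold SatisfiesHeun at heq₁ heq₂
  rw [← hsq] at heq₁ heq₂
  have hinv : F₁ z * F₂ z / S z = S z * (1 / S z ^ 2) * (F₁ z * F₂ z) := by
    field_simp
  rw [hinv]
  linear_combination S z * F₂ z * heq₁ - S z * F₁ z * heq₂

/-- Proposition 1 (orthogonality of solutions with different eigenvalues). -/
theorem heun_orthogonality
    (z₁ z₂ z₃ z₄ q₁ q₂ q₃ q₄ lam₁ lam₂ : ℂ)
    (hd : z₁ ≠ z₂ ∧ z₁ ≠ z₃ ∧ z₁ ≠ z₄ ∧ z₂ ≠ z₃ ∧ z₂ ≠ z₄ ∧ z₃ ≠ z₄)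
    (hlam : lam₁ ≠ lam₂)
    (U : Set ℂ) (hU : IsOpen U)
    (hUz : z₁ ∉ U ∧ z₂ ∉ U ∧ z₃ ∉ U ∧ z₄ ∉ U)
    (S : ℂ → ℂ)
    (hSdiff : ∀ z ∈ U, DifferentiableAt ℂ S z)
    (hSsq : ∀ z ∈ U, S z ^ 2 = (z - z₁) * (z - z₂) * (z - z₃) * (z - z₄))
    (hS0 : ∀ z ∈ U, S z ≠ 0)
    (F₁ F₂ : ℂ → ℂ)
    (hF₁ : ∀ z ∈ U, DifferentiableAt ℂ F₁ z)
    (hF₁' : ∀ z ∈ U, DifferentiableAt ℂ (deriv F₁) z)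
    (hF₂ : ∀ z ∈ U, DifferentiableAt ℂ F₂ z)
    (hF₂' : ∀ z ∈ U, DifferentiableAt ℂ (deriv F₂) z)
    (heq₁ : ∀ z ∈ U, SatisfiesHeun z₁ z₂ z₃ z₄ q₁ q₂ q₃ q₄ lam₁ F₁ z)
    (heq₂ : ∀ z ∈ U, SatisfiesHeun z₁ z₂ z₃ z₄ q₁ q₂ q₃ q₄ lam₂ F₂ z)
    (γ : ℝ → ℂ)
    (hγU : ∀ t ∈ Set.Ioo (0 : ℝ) 1, γ t ∈ U)
    (hγC1 : ContDiffOn ℝ 1 γ (Set.Ioo (0 : ℝ) 1))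
    (hW0 : Filter.Tendsto
      (fun t => S (γ t) * (F₁ (γ t) * deriv F₂ (γ t) - F₂ (γ t) * deriv F₁ (γ t)))
      (nhdsWithin (0 : ℝ) (Set.Ioi 0)) (nhds 0))
    (hW1 : Filter.Tendsto
      (fun t => S (γ t) * (F₁ (γ t) * deriv F₂ (γ t) - F₂ (γ t) * deriv F₁ (γ t)))
      (nhdsWithin (1 : ℝ) (Set.Iio 1)) (nhds 0))
    (hint : IntegrableOn (fun t => F₁ (γ t) * F₂ (γ t) * deriv γ t / S (γ t))
      (Set.Ioo (0 : ℝ) 1)) :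
    ∫ t in Set.Ioo (0 : ℝ) 1, F₁ (γ t) * F₂ (γ t) * deriv γ t / S (γ t) = 0 := by
  have hderiv : ∀ t ∈ Set.Ioo (0 : ℝ) 1, HasDerivAt
      (fun t => S (γ t) * (F₁ (γ t) * deriv F₂ (γ t) - F₂ (γ t) * deriv F₁ (γ t)))
      ((lam₁ - lam₂) * (F₁ (γ t) * F₂ (γ t) * deriv γ t / S (γ t))) t := by
    intro t ht
    have hz := hγU t ht
    have hγ : HasDerivAt γ (deriv γ t) t :=
      ((hγC1.contDiffAt (isOpen_Ioo.mem_nhds ht)).differentiableAt one_ne_zero).hasDerivAt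
    have hS := hasDerivAt_sqrt_quartic (hU.mem_nhds hz) (hSdiff _ hz) hSsq (hS0 _ hz)
    have hW := SatisfiesHeun.hasDerivAt_wronskian hS (hSsq _ hz) (hS0 _ hz)
      (hF₁ _ hz) (hF₁' _ hz) (hF₂ _ hz) (hF₂' _ hz) (heq₁ _ hz) (heq₂ _ hz)
    refine (hW.comp t hγ).congr_deriv ?_
    ring
  have hint' : IntervalIntegrable
      (fun t => (lam₁ - lam₂) * (F₁ (γ t) * F₂ (γ t) * deriv γ t / S (γ t))) volume 0 1 :=
    (intervalIntegrable_iff_integrableOn_Ioo_of_le zero_le_one).2 (hint.const_mul _)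
  have h := intervalIntegral.integral_eq_sub_of_hasDerivAt_of_tendsto zero_lt_one hderiv hint'
    hW0 hW1
  rw [intervalIntegral.integral_const_mul, sub_zero, intervalIntegral.integral_of_le zero_le_one,
    integral_Ioc_eq_integral_Ioo] at h
  exact (mul_eq_zero.1 h).resolve_left (sub_ne_zero.2 hlam)
end

section
/- (Proposition 2(iii), inversion.) Let z₁, z₂, z₃, z₄ ∈ ℂ be pairwise distinct and nonzero, q₁, q₂, q₃, q₄ ∈ ℂ, λ ∈ ℂ, and set σ₄ = z₁·z₂·z₃·z₄. If a twice differentiable function F satisfies the symmetric Heun equation with data (z₁,…,z₄; q₁,…,q₄; λ) at a point w ∉ {0, z₁, z₂, z₃, z₄}, then the function G(z) = F(1/z) satisfies the symmetric Heun equation with data (1/z₁,…,1/z₄; −q₁/(z₁²·σ₄),…,−q₄/(z₄²·σ₄); (λ − Σ_{j=1}^4 q_j/z_j)/σ₄) at the point 1/w. -/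
open Complex

/-- The derivative of `z ↦ F (1 / z)`. -/
theorem hasDerivAt_comp_one_div {F : ℂ → ℂ} {z : ℂ} (hz : z ≠ 0)
    (hF : DifferentiableAt ℂ F (1 / z)) :
    HasDerivAt (fun u => F (1 / u)) (-(z ^ 2)⁻¹ * deriv F (1 / z)) z := by
  have hinv : HasDerivAt (fun u : ℂ => 1 / u) (-(z ^ 2)⁻¹) z := by
    simpa only [one_div] using hasDerivAt_inv hz
  rw [mul_comm]
  exact hF.hasDerivAt.comp z hinv

/-- The second derivative of `z ↦ F (1 / z)` at `1 / w`. -/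
theorem deriv_deriv_comp_one_div {F : ℂ → ℂ} {w : ℂ} (hw : w ≠ 0)
    (hF : ∀ᶠ z in nhds w, DifferentiableAt ℂ F z)
    (hF' : DifferentiableAt ℂ (deriv F) w) :
    deriv (deriv fun z => F (1 / z)) (1 / w) =
      w ^ 4 * deriv (deriv F) w + 2 * w ^ 3 * deriv F w := by
  have hu : (1 / w : ℂ) ≠ 0 := one_div_ne_zero hw
  have hcont : Filter.Tendsto (fun z : ℂ => 1 / z) (nhds (1 / w)) (nhds w) := by
    have h : ContinuousAt (fun z : ℂ => 1 / z) (1 / w) :=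
      continuousAt_const.div continuousAt_id hu
    simpa only [ContinuousAt, one_div_one_div] using h
  have hderiv : deriv (fun z => F (1 / z)) =ᶠ[nhds (1 / w)]
      fun z => -(z ^ 2)⁻¹ * deriv F (1 / z) := by
    filter_upwards [hcont.eventually hF, eventually_ne_nhds hu] with z hz hz0
    exact (hasDerivAt_comp_one_div hz0 hz).deriv
  have hsq : HasDerivAt (fun z : ℂ => -(z ^ 2)⁻¹) (2 * w ^ 3) (1 / w) := by
    refine ((hasDerivAt_pow 2 (1 / w)).inv (pow_ne_zero 2 hu)).neg.congr_deriv ?_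
    have hw' : w * w⁻¹ = 1 := mul_inv_cancel₀ hw
    field_simp
    norm_num
    linear_combination 2 * hw'
  have hcomp := hasDerivAt_comp_one_div hu (F := deriv F) (by rwa [one_div_one_div])
  rw [hderiv.deriv_eq]
  refine (hsq.mul hcomp).deriv.trans ?_
  rw [one_div_one_div]
  field_simp
  ring

/-- A reciprocal difference after inversion. -/
theorem one_div_one_div_sub_one_div {w a : ℂ} (hw : w ≠ 0) (ha : a ≠ 0) (hwa : w ≠ a) :
    1 / (1 / w - 1 / a) = w - w ^ 2 * (1 / (w - a)) := by
  have h : w - a ≠ 0 := sub_ne_zero.2 hwa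
  have h' : 1 / w - 1 / a = -(w - a) / (w * a) := by
    field_simp
    ring
  rw [h']
  field_simp
  ring

/-- An accessory parameter term after inversion. -/
theorem neg_div_one_div_sub_one_div {w a s : ℂ} (q : ℂ) (hw : w ≠ 0) (ha : a ≠ 0)
    (hwa : w ≠ a) (hs : s ≠ 0) :
    (-q / (a ^ 2 * s)) / (1 / w - 1 / a) = (q / a + q / (w - a)) / s := by
  have h : w - a ≠ 0 := sub_ne_zero.2 hwa
  rw [div_eq_mul_one_div, one_div_one_div_sub_one_div hw ha hwa]
  field_simp
  ring

/-- Proposition 2(iii): invariance of the symmetric Heun equation under inversion. -/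
theorem heun_inversion_invariance
    (z₁ z₂ z₃ z₄ q₁ q₂ q₃ q₄ lam w : ℂ)
    (hd : z₁ ≠ z₂ ∧ z₁ ≠ z₃ ∧ z₁ ≠ z₄ ∧ z₂ ≠ z₃ ∧ z₂ ≠ z₄ ∧ z₃ ≠ z₄)
    (hz0 : z₁ ≠ 0 ∧ z₂ ≠ 0 ∧ z₃ ≠ 0 ∧ z₄ ≠ 0)
    (hw : w ≠ 0 ∧ w ≠ z₁ ∧ w ≠ z₂ ∧ w ≠ z₃ ∧ w ≠ z₄)
    (σ₄ : ℂ) (hσ₄ : σ₄ = z₁ * z₂ * z₃ * z₄)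
    (F : ℂ → ℂ)
    (hF : ∀ᶠ z in nhds w, DifferentiableAt ℂ F z)
    (hF' : DifferentiableAt ℂ (deriv F) w)
    (heq : SatisfiesHeun z₁ z₂ z₃ z₄ q₁ q₂ q₃ q₄ lam F w) :
    SatisfiesHeun (1 / z₁) (1 / z₂) (1 / z₃) (1 / z₄)
      (-q₁ / (z₁ ^ 2 * σ₄)) (-q₂ / (z₂ ^ 2 * σ₄)) (-q₃ / (z₃ ^ 2 * σ₄)) (-q₄ / (z₄ ^ 2 * σ₄))
      ((lam - (q₁ / z₁ + q₂ / z₂ + q₃ / z₃ + q₄ / z₄)) / σ₄)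
      (fun z => F (1 / z)) (1 / w) := by
  obtain ⟨h₁, h₂, h₃, h₄⟩ := hz0
  obtain ⟨hw0, hw₁, hw₂, hw₃, hw₄⟩ := hw
  have hσ : σ₄ ≠ 0 := by
    rw [hσ₄]
    exact mul_ne_zero (mul_ne_zero (mul_ne_zero h₁ h₂) h₃) h₄
  have hu : (1 / w : ℂ) ≠ 0 := one_div_ne_zero hw0
  have hG : deriv (fun z => F (1 / z)) (1 / w) = -w ^ 2 * deriv F w := by
    rw [(hasDerivAt_comp_one_div hu (by simpa using hF.self_of_nhds)).deriv, one_div_one_div]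
    simp
  have hsub : ∀ a : ℂ, a ≠ 0 → 1 / w - 1 / a = -(w - a) / (w * a) := by
    intro a ha
    field_simp
    ring
  have hP : 1 / ((1 / w - 1 / z₁) * (1 / w - 1 / z₂) * (1 / w - 1 / z₃) * (1 / w - 1 / z₄)) =
      w ^ 4 * σ₄ * (1 / ((w - z₁) * (w - z₂) * (w - z₃) * (w - z₄))) := by
    have k₁ := sub_ne_zero.2 hw₁
    have k₂ := sub_ne_zero.2 hw₂
    have k₃ := sub_ne_zero.2 hw₃
    have k₄ := sub_ne_zero.2 hw₄
    rw [hsub z₁ h₁, hsub z₂ h₂, hsub z₃ h₃, hsub z₄ h₄, hσ₄]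
    field_simp
  unfold SatisfiesHeun at heq ⊢
  rw [deriv_deriv_comp_one_div hw0 hF hF', hG, hP,
    neg_div_one_div_sub_one_div q₁ hw0 h₁ hw₁ hσ, neg_div_one_div_sub_one_div q₂ hw0 h₂ hw₂ hσ,
    neg_div_one_div_sub_one_div q₃ hw0 h₃ hw₃ hσ, neg_div_one_div_sub_one_div q₄ hw0 h₄ hw₄ hσ,
    one_div_one_div_sub_one_div hw0 h₁ hw₁, one_div_one_div_sub_one_div hw0 h₂ hw₂,
    one_div_one_div_sub_one_div hw0 h₃ hw₃, one_div_one_div_sub_one_div hw0 h₄ hw₄]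
  simp only [one_div_one_div]
  have hq : (lam - (q₁ / z₁ + q₂ / z₂ + q₃ / z₃ + q₄ / z₄)) / σ₄
      + (q₁ / z₁ + q₁ / (w - z₁)) / σ₄ + (q₂ / z₂ + q₂ / (w - z₂)) / σ₄
      + (q₃ / z₃ + q₃ / (w - z₃)) / σ₄ + (q₄ / z₄ + q₄ / (w - z₄)) / σ₄
      = (lam + q₁ / (w - z₁) + q₂ / (w - z₂) + q₃ / (w - z₃) + q₄ / (w - z₄)) * σ₄⁻¹ := by
    ring
  rw [hq]
  have hσinv : σ₄ * σ₄⁻¹ = 1 := mul_inv_cancel₀ hσ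
  generalize lam + q₁ / (w - z₁) + q₂ / (w - z₂) + q₃ / (w - z₃) + q₄ / (w - z₄) = Q at heq ⊢
  generalize 1 / ((w - z₁) * (w - z₂) * (w - z₃) * (w - z₄)) = R at heq ⊢
  linear_combination w ^ 4 * heq + w ^ 4 * R * Q * F w * hσinv
end
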